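/- Grushko's theorem: if G₁ and G₂ are nontrivial finitely generated groups, then the rank of their free product satisfies rk(G₁ ∗ G₂) = rk(G₁) + rk(G₂). -/

import Mathlib

/-- The rank of a group: the smallest cardinality of a (finite) generating set. -/
noncomputable def groupRank (G : Type*) [Group G] : ℕ :=
  sInf {n : ℕ | ∃ S : Finset G, S.card = n ∧ Subgroup.closure (S : Set G) = ⊤}

namespace GrushkoAux

/-- The groupoid generated by a set of labelled edges `s x g y`. -/
inductive Gen {E G : Type*} [Group G] (s : E → G → E → Prop) : E → G → E → Prop
  | refl (x : E) : Gen s x 1 x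
  | of {x : E} {g : G} {y : E} : s x g y → Gen s x g y
  | symm {x : E} {g : G} {y : E} : Gen s x g y → Gen s y g⁻¹ x
  | trans {x : E} {g : G} {y : E} {h : G} {z : E} :
      Gen s x g y → Gen s y h z → Gen s x (g * h) z

theorem Gen.lift {E E' G H : Type*} [Group G] [Group H] {s : E → G → E → Prop}
    {t : E' → H → E' → Prop} (f : E → E') (φ : G →* H)
    (hs : ∀ x g y, s x g y → Gen t (f x) (φ g) (f y)) {x : E} {g : G} {y : E}
    (h : Gen s x g y) : Gen t (f x) (φ g) (f y) := by
  induction h with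
  | refl x => simpa using Gen.refl (f x)
  | of h => exact hs _ _ _ h
  | symm _ ih => simpa using ih.symm
  | trans _ _ ih1 ih2 => simpa using ih1.trans ih2

/-- Membership in a finite edge set, as a relation. -/
def Mem {E G : Type*} (S : Finset (E × G × E)) : E → G → E → Prop :=
  fun x g y => (x, g, y) ∈ S

/-- Spanning tree data. -/
def Good {E A : Type*} [Group A] (S : Finset (E × A × E)) (e : E) (D : Finset E) : Prop :=
  e ∈ D ∧ ∃ (c : E → A) (T : Finset (E × A × E)), T ⊆ S ∧ c e = 1 ∧ D.card ≤ T.card + 1 ∧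
    ∀ x a y, (x, a, y) ∈ T → x ∈ D ∧ y ∈ D ∧ c x * a = c y

open Classical in
theorem good_step {E A : Type*} [Group A] (S : Finset (E × A × E)) (e : E) (D : Finset E)
    (hD : Good S e D) (x : E) (a : A) (y : E) (hS : (x, a, y) ∈ S) (hxy : ¬ (x ∈ D ↔ y ∈ D)) :
    ∃ D', Good S e D' ∧ D.card < D'.card := by
  obtain ⟨heD, c, T, hTS, hce, hcard, hT⟩ := hD
  have hnT : (x, a, y) ∉ T := fun h => hxy (by have := hT _ _ _ h; tauto)
  by_cases hx : x ∈ D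
  · have hy : y ∉ D := by tauto
    refine ⟨insert y D, ⟨by simp [heD], Function.update c y (c x * a), insert (x, a, y) T,
      ?_, ?_, ?_, ?_⟩, ?_⟩
    · intro p hp
      rcases Finset.mem_insert.1 hp with rfl | hp
      · exact hS
      · exact hTS hp
    · rw [Function.update_of_ne (by rintro rfl; exact hy heD), hce]
    · rw [Finset.card_insert_of_notMem hy, Finset.card_insert_of_notMem hnT]; omega
    · intro x' a' y' h
      have hxn : x ≠ y := by rintro rfl; exact hy hx
      rcases Finset.mem_insert.1 h with h | h
      · obtain ⟨rfl, rfl, rfl⟩ : x' = x ∧ a' = a ∧ y' = y := by simpa using h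
        simp [hx, Function.update_of_ne hxn]
      · obtain ⟨h1, h2, h3⟩ := hT _ _ _ h
        have n1 : x' ≠ y := by rintro rfl; exact hy h1
        have n2 : y' ≠ y := by rintro rfl; exact hy h2
        simp [h1, h2, Function.update_of_ne n1, Function.update_of_ne n2, h3]
    · rw [Finset.card_insert_of_notMem hy]; omega
  · have hy : y ∈ D := by tauto
    refine ⟨insert x D, ⟨by simp [heD], Function.update c x (c y * a⁻¹), insert (x, a, y) T,
      ?_, ?_, ?_, ?_⟩, ?_⟩
    · intro p hp
      rcases Finset.mem_insert.1 hp with rfl | hp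
      · exact hS
      · exact hTS hp
    · rw [Function.update_of_ne (by rintro rfl; exact hx heD), hce]
    · rw [Finset.card_insert_of_notMem hx, Finset.card_insert_of_notMem hnT]; omega
    · intro x' a' y' h
      have hxn : y ≠ x := by rintro rfl; exact hx hy
      rcases Finset.mem_insert.1 h with h | h
      · obtain ⟨rfl, rfl, rfl⟩ : x' = x ∧ a' = a ∧ y' = y := by simpa using h
        simp [hy, Function.update_of_ne hxn]
      · obtain ⟨h1, h2, h3⟩ := hT _ _ _ h
        have n1 : x' ≠ x := by rintro rfl; exact hx h1
        have n2 : y' ≠ x := by rintro rfl; exact hx h2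
        simp [h1, h2, Function.update_of_ne n1, Function.update_of_ne n2, h3]
    · rw [Finset.card_insert_of_notMem hx]; omega

open Classical in
theorem exists_max_good {E A : Type*} [Fintype E] [Group A] (S : Finset (E × A × E)) (e : E) :
    ∃ D, Good S e D ∧ ∀ x a y, (x, a, y) ∈ S → (x ∈ D ↔ y ∈ D) := by
  have h0 : Good S e {e} := ⟨by simp, fun _ => 1, ∅, by simp, rfl, by simp, by simp⟩
  obtain ⟨D, hD, hmax⟩ := Finset.exists_max_image
    ((Finset.univ : Finset (Finset E)).filter (Good S e)) Finset.card ⟨{e}, by simpa using h0⟩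
  have hD' : Good S e D := by simpa using hD
  refine ⟨D, hD', fun x a y hS => ?_⟩
  by_contra hxy
  obtain ⟨D', h1, h2⟩ := good_step S e D hD' x a y hS hxy
  have := hmax D' (by simpa using h1)
  omega

open Classical in
/-- The map identifying the second vertex with the first. -/
noncomputable def proj {E : Type*} {e e' : E} (hne : e ≠ e') (x : E) : {x : E // x ≠ e'} :=
  if h : x = e' then ⟨e, hne⟩ else ⟨x, h⟩

open Classical in
theorem fold {E A : Type*} [Fintype E] [Group A] (S : Finset (E × A × E)) {e e' : E}
    (hne : e ≠ e') (h : Gen (Mem S) e 1 e') :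
    ∃ S' : Finset ({x : E // x ≠ e'} × A × {x : E // x ≠ e'}), S'.card + 1 ≤ S.card ∧
      ∀ x a y, Mem S x a y → Gen (Mem S') (proj hne x) a (proj hne y) := by
  obtain ⟨D, ⟨heD, c, T, hTS, hce, hcard, hT⟩, hD⟩ := exists_max_good S e
  set N : Finset (E × A × E) := (S.filter (fun p => p.1 ∈ D)) \ T with hN
  set lab : E × A × E → A := fun p => c p.1 * p.2.1 * (c p.2.2)⁻¹ with hlab
  set H : Subgroup A := Subgroup.closure (lab '' (N : Set (E × A × E))) with hH
  have hlabH : ∀ x a y, (x, a, y) ∈ S → x ∈ D → c x * a * (c y)⁻¹ ∈ H := by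
    intro x a y hS hx
    by_cases hxT : (x, a, y) ∈ T
    · rw [(hT _ _ _ hxT).2.2]; simp [H.one_mem]
    · exact Subgroup.subset_closure ⟨(x, a, y), by simp [hN, hS, hx, hxT], rfl⟩
  have hinv : ∀ x a y, Gen (Mem S) x a y → (x ∈ D ↔ y ∈ D) ∧ (x ∈ D → c x * a * (c y)⁻¹ ∈ H) := by
    intro x a y hg
    induction hg with
    | refl x => simp [H.one_mem]
    | of h => exact ⟨hD _ _ _ h, hlabH _ _ _ h⟩
    | symm _ ih =>
      refine ⟨ih.1.symm, fun hy => ?_⟩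
      have := H.inv_mem (ih.2 (ih.1.2 hy))
      simpa [mul_assoc] using this
    | trans _ _ ih1 ih2 =>
      refine ⟨ih1.1.trans ih2.1, fun hx => ?_⟩
      have := H.mul_mem (ih1.2 hx) (ih2.2 (ih1.1.1 hx))
      simpa [mul_assoc] using this
  obtain ⟨he'1, he'2⟩ := hinv _ _ _ h
  have he'D : e' ∈ D := he'1.1 heD
  have hce' : c e' ∈ H := by
    have := H.inv_mem (he'2 heD)
    simpa [hce] using this
  set b : {x : E // x ≠ e'} := ⟨e, hne⟩ with hb
  set S1 := (S.filter (fun p => p.1 ∉ D)).image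
    (fun p => ((proj hne p.1, p.2.1, proj hne p.2.2) : {x : E // x ≠ e'} × A × {x : E // x ≠ e'}))
    with hS1
  set S2 := ((D.erase e).erase e').image
    (fun y => ((b, c y, proj hne y) : {x : E // x ≠ e'} × A × {x : E // x ≠ e'})) with hS2
  set S3 := N.image (fun p => ((b, lab p, b) : {x : E // x ≠ e'} × A × {x : E // x ≠ e'})) with hS3
  have hpe : proj hne e = b := by simp [proj, hne, hb]
  have hpe' : proj hne e' = b := by simp [proj, hb]
  have key : ∀ g ∈ H, Gen (Mem (S1 ∪ S2 ∪ S3)) b g b := by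
    intro g hg
    induction hg using Subgroup.closure_induction with
    | mem x hx =>
      obtain ⟨p, hp, rfl⟩ := hx
      refine Gen.of ?_
      exact Finset.mem_union_right _ (Finset.mem_image.2 ⟨p, hp, rfl⟩)
    | one => exact Gen.refl _
    | mul x y _ _ h1 h2 => exact h1.trans h2
    | inv x _ h1 => exact h1.symm
  have key2 : ∀ y ∈ D, Gen (Mem (S1 ∪ S2 ∪ S3)) b (c y) (proj hne y) := by
    intro y hy
    by_cases h1 : y = e
    · subst h1; rw [hce, hpe]; exact Gen.refl _
    by_cases h2 : y = e'
    · subst h2; rw [hpe']; exact key _ hce'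
    refine Gen.of ?_
    refine Finset.mem_union_left _ (Finset.mem_union_right _ (Finset.mem_image.2 ⟨y, ?_, rfl⟩))
    simp [h1, h2, hy]
  refine ⟨S1 ∪ S2 ∪ S3, ?_, ?_⟩
  · have c1 : S1.card ≤ (S.filter (fun p => p.1 ∉ D)).card := Finset.card_image_le
    have c2 : S2.card ≤ ((D.erase e).erase e').card := Finset.card_image_le
    have c3 : S3.card ≤ N.card := Finset.card_image_le
    have hsub : T ⊆ S.filter (fun p => p.1 ∈ D) := by
      rintro ⟨x, a, y⟩ hp
      exact Finset.mem_filter.2 ⟨hTS hp, (hT _ _ _ hp).1⟩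
    have c4 : N.card + T.card = (S.filter (fun p => p.1 ∈ D)).card :=
      Finset.card_sdiff_add_card_eq_card hsub
    have c5 := Finset.card_filter_add_card_filter_not (s := S) (fun p => p.1 ∈ D)
    have c6 := Finset.card_union_le (S1 ∪ S2) S3
    have c7 := Finset.card_union_le S1 S2
    have c8 : ((D.erase e).erase e').card + 1 = (D.erase e).card :=
      Finset.card_erase_add_one (by simp [he'D, hne.symm])
    have c9 : (D.erase e).card + 1 = D.card := Finset.card_erase_add_one heD
    omega
  · intro x a y hS
    by_cases hx : x ∈ D
    · have hy := (hD _ _ _ hS).1 hx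
      have := ((key2 x hx).symm.trans (key _ (hlabH _ _ _ hS hx))).trans (key2 y hy)
      simpa [mul_assoc] using this
    · refine Gen.of ?_
      refine Finset.mem_union_left _ (Finset.mem_union_left _
        (Finset.mem_image.2 ⟨(x, a, y), ?_, rfl⟩))
      simp only [Finset.mem_filter]
      exact ⟨hS, hx⟩

section Graphs

variable {A B : Type*} [Group A] [Group B]

open Monoid

/-- The total edge relation of a graph with edges labelled by `A` and by `B`. -/
def Tot {E : Type} (SA : Finset (E × A × E)) (SB : Finset (E × B × E)) :
    E → Coprod A B → E → Prop :=
  fun x g y => (∃ a, g = Coprod.inl a ∧ Mem SA x a y) ∨ (∃ b, g = Coprod.inr b ∧ Mem SB x b y)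

/-- A finite connected graph with Betti number at most `n`, whose loops realise all of `K`,
and having a path with label `h` from the base point. -/
def Q (n : ℕ) (K : Set (Coprod A B)) (h : Coprod A B) : Prop :=
  ∃ (E : Type) (_ : Fintype E) (SA : Finset (E × A × E)) (SB : Finset (E × B × E)) (e v : E),
    SA.card + SB.card + 1 ≤ n + Fintype.card E ∧
    (∀ k ∈ K, Gen (Tot SA SB) e k e) ∧ (∀ x, ∃ g, Gen (Tot SA SB) e g x) ∧
    Gen (Tot SA SB) e h v

/-- A finite graph with Betti number at most `n` generating everything. -/
def P (A B : Type*) [Group A] [Group B] (n m : ℕ) : Prop :=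
  ∃ (E : Type) (_ : Fintype E) (SA : Finset (E × A × E)) (SB : Finset (E × B × E)),
    Fintype.card E = m ∧ 0 < m ∧
    SA.card + SB.card + 1 ≤ n + Fintype.card E ∧
    ∀ x g y, Gen (Tot SA SB) x g y

open Classical in
theorem Q_inl {n : ℕ} {K : Set (Coprod A B)} {h : Coprod A B} (hQ : Q n K h) (a : A) :
    Q n K (h * Coprod.inl a) := by
  obtain ⟨E, _, SA, SB, e, v, hc, hK, hconn, hh⟩ := hQ
  set SA' : Finset (Option E × A × Option E) :=
    insert (some v, a, none) (SA.image fun p => (some p.1, p.2.1, some p.2.2))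
  set SB' : Finset (Option E × B × Option E) := SB.image fun p => (some p.1, p.2.1, some p.2.2)
  have hmap : ∀ {x g y}, Gen (Tot SA SB) x g y → Gen (Tot SA' SB') (some x) g (some y) := by
    intro x g y hg
    refine Gen.lift some (MonoidHom.id _) ?_ hg
    rintro x g y (⟨a, rfl, hm⟩ | ⟨a, rfl, hm⟩)
    · exact Gen.of (Or.inl ⟨a, rfl, Finset.mem_insert_of_mem
        (Finset.mem_image.2 ⟨(x, a, y), hm, rfl⟩)⟩)
    · exact Gen.of (Or.inr ⟨a, rfl, Finset.mem_image.2 ⟨(x, a, y), hm, rfl⟩⟩)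
  have hnew : Gen (Tot SA' SB') (some v) (Coprod.inl a) none :=
    Gen.of (Or.inl ⟨a, rfl, Finset.mem_insert_self _ _⟩)
  refine ⟨Option E, inferInstance, SA', SB', some e, none, ?_, fun k hk => hmap (hK k hk), ?_,
    (hmap hh).trans hnew⟩
  · have c1 : SA'.card ≤ SA.card + 1 :=
      (Finset.card_insert_le _ _).trans (Nat.add_le_add_right Finset.card_image_le 1)
    have c2 : SB'.card ≤ SB.card := Finset.card_image_le
    rw [Fintype.card_option]; omega
  · rintro (_ | x)
    · exact ⟨_, (hmap hh).trans hnew⟩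
    · obtain ⟨g, hg⟩ := hconn x
      exact ⟨g, hmap hg⟩

open Classical in
theorem Q_inr {n : ℕ} {K : Set (Coprod A B)} {h : Coprod A B} (hQ : Q n K h) (b : B) :
    Q n K (h * Coprod.inr b) := by
  obtain ⟨E, _, SA, SB, e, v, hc, hK, hconn, hh⟩ := hQ
  set SA' : Finset (Option E × A × Option E) := SA.image fun p => (some p.1, p.2.1, some p.2.2)
  set SB' : Finset (Option E × B × Option E) :=
    insert (some v, b, none) (SB.image fun p => (some p.1, p.2.1, some p.2.2))
  have hmap : ∀ {x g y}, Gen (Tot SA SB) x g y → Gen (Tot SA' SB') (some x) g (some y) := by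
    intro x g y hg
    refine Gen.lift some (MonoidHom.id _) ?_ hg
    rintro x g y (⟨a, rfl, hm⟩ | ⟨a, rfl, hm⟩)
    · exact Gen.of (Or.inl ⟨a, rfl, Finset.mem_image.2 ⟨(x, a, y), hm, rfl⟩⟩)
    · exact Gen.of (Or.inr ⟨a, rfl, Finset.mem_insert_of_mem
        (Finset.mem_image.2 ⟨(x, a, y), hm, rfl⟩)⟩)
  have hnew : Gen (Tot SA' SB') (some v) (Coprod.inr b) none :=
    Gen.of (Or.inr ⟨b, rfl, Finset.mem_insert_self _ _⟩)
  refine ⟨Option E, inferInstance, SA', SB', some e, none, ?_, fun k hk => hmap (hK k hk), ?_,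
    (hmap hh).trans hnew⟩
  · have c1 : SB'.card ≤ SB.card + 1 :=
      (Finset.card_insert_le _ _).trans (Nat.add_le_add_right Finset.card_image_le 1)
    have c2 : SA'.card ≤ SA.card := Finset.card_image_le
    rw [Fintype.card_option]; omega
  · rintro (_ | x)
    · exact ⟨_, (hmap hh).trans hnew⟩
    · obtain ⟨g, hg⟩ := hconn x
      exact ⟨g, hmap hg⟩

theorem Q_mul {n : ℕ} {K : Set (Coprod A B)} (g : Coprod A B) :
    ∀ {h : Coprod A B}, Q n K h → Q n K (h * g) := by
  induction g using Coprod.induction_on with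
  | inl a => exact fun h => Q_inl h a
  | inr b => exact fun h => Q_inr h b
  | mul x y ihx ihy =>
    intro h hQ
    rw [← mul_assoc]
    exact ihy (ihx hQ)

open Classical in
theorem Q_close {n : ℕ} {K : Set (Coprod A B)} {g : Coprod A B} (hQ : Q n K g) :
    Q (n + 1) (insert g K) 1 := by
  obtain ⟨E, _, SA, SB, e, v, hc, hK, hconn, hh⟩ := hQ
  have hmap : ∀ {x g y}, Gen (Tot SA SB) x g y →
      Gen (Tot (insert (v, 1, e) SA) SB) x g y := by
    intro x g y hg
    refine Gen.lift id (MonoidHom.id _) ?_ hg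
    rintro x g y (⟨a, rfl, hm⟩ | ⟨a, rfl, hm⟩)
    · exact Gen.of (Or.inl ⟨a, rfl, Finset.mem_insert_of_mem hm⟩)
    · exact Gen.of (Or.inr ⟨a, rfl, hm⟩)
  have hnew : Gen (Tot (insert (v, 1, e) SA) SB) v (Coprod.inl 1) e :=
    Gen.of (Or.inl ⟨1, rfl, Finset.mem_insert_self _ _⟩)
  refine ⟨E, inferInstance, insert (v, 1, e) SA, SB, e, e, ?_, ?_, ?_, Gen.refl _⟩
  · have := Finset.card_insert_le (v, (1 : A), e) SA
    omega
  · rintro k (rfl | hk)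
    · simpa using (hmap hh).trans hnew
    · exact hmap (hK k hk)
  · intro x
    obtain ⟨g, hg⟩ := hconn x
    exact ⟨g, hmap hg⟩

theorem Q_finset (K : Finset (Coprod A B)) : Q K.card (K : Set (Coprod A B)) 1 := by
  classical
  induction K using Finset.induction_on with
  | empty =>
    refine ⟨Unit, inferInstance, ∅, ∅, (), (), by simp, by simp, fun x => ⟨1, Gen.refl _⟩,
      Gen.refl _⟩
  | insert g K hg ih =>
    rw [Finset.card_insert_of_notMem hg, Finset.coe_insert]
    apply Q_close
    simpa using Q_mul g ih

theorem exists_P (K : Finset (Coprod A B)) (hK : Subgroup.closure (K : Set (Coprod A B)) = ⊤) :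
    ∃ m, P A B K.card m := by
  obtain ⟨E, _, SA, SB, e, v, hc, hl, hconn, hh⟩ := Q_finset K
  refine ⟨Fintype.card E, E, inferInstance, SA, SB, rfl, Fintype.card_pos_iff.2 ⟨e⟩, hc, ?_⟩
  have hall : ∀ g, Gen (Tot SA SB) e g e := by
    intro g
    have hg : g ∈ Subgroup.closure (K : Set (Coprod A B)) := by rw [hK]; trivial
    induction hg using Subgroup.closure_induction with
    | mem x hx => exact hl x hx
    | one => exact Gen.refl _
    | mul x y _ _ h1 h2 => exact h1.trans h2
    | inv x _ h1 => exact h1.symm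
  intro x g y
  obtain ⟨p, hp⟩ := hconn x
  obtain ⟨q, hq⟩ := hconn y
  have := (hp.symm.trans (hall (p * g * q⁻¹))).trans hq
  simpa [mul_assoc] using this

open Classical in
theorem P_foldA {n : ℕ} {E : Type} [Fintype E] {SA : Finset (E × A × E)} {SB : Finset (E × B × E)}
    (hc : SA.card + SB.card + 1 ≤ n + Fintype.card E)
    (hall : ∀ x g y, Gen (Tot SA SB) x g y) {e e' : E} (hne : e ≠ e')
    (h : Gen (Mem SA) e 1 e') : ∃ m, m < Fintype.card E ∧ P A B n m := by
  obtain ⟨SA', hcard, hS⟩ := fold SA hne h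
  set SB' : Finset ({x : E // x ≠ e'} × B × {x : E // x ≠ e'}) :=
    SB.image fun p => (proj hne p.1, p.2.1, proj hne p.2.2)
  have hE : Fintype.card {x : E // x ≠ e'} + 1 = Fintype.card E := by
    have h1 := Fintype.card_subtype_compl (fun x : E => x = e')
    have h2 : 0 < Fintype.card E := Fintype.card_pos_iff.2 ⟨e⟩
    simp at h1 ⊢
    omega
  have hmap : ∀ {x g y}, Gen (Tot SA SB) x g y →
      Gen (Tot SA' SB') (proj hne x) g (proj hne y) := by
    intro x g y hg
    refine Gen.lift (proj hne) (MonoidHom.id _) ?_ hg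
    rintro x g y (⟨a, rfl, hm⟩ | ⟨a, rfl, hm⟩)
    · exact Gen.lift (t := Tot SA' SB') id Coprod.inl (fun x a y hm => Gen.of (Or.inl ⟨a, rfl, hm⟩)) (hS _ _ _ hm)
    · exact Gen.of (Or.inr ⟨a, rfl, Finset.mem_image.2 ⟨(x, a, y), hm, rfl⟩⟩)
  refine ⟨Fintype.card {x : E // x ≠ e'}, by omega, {x : E // x ≠ e'}, inferInstance, SA', SB',
    rfl, Fintype.card_pos_iff.2 ⟨⟨e, hne⟩⟩, ?_, ?_⟩
  · have c2 : SB'.card ≤ SB.card := Finset.card_image_le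
    omega
  · intro x g y
    have := hmap (hall x.1 g y.1)
    simpa [proj, x.2, y.2] using this

open Classical in
theorem P_foldB {n : ℕ} {E : Type} [Fintype E] {SA : Finset (E × A × E)} {SB : Finset (E × B × E)}
    (hc : SA.card + SB.card + 1 ≤ n + Fintype.card E)
    (hall : ∀ x g y, Gen (Tot SA SB) x g y) {e e' : E} (hne : e ≠ e')
    (h : Gen (Mem SB) e 1 e') : ∃ m, m < Fintype.card E ∧ P A B n m := by
  obtain ⟨SB', hcard, hS⟩ := fold SB hne h
  set SA' : Finset ({x : E // x ≠ e'} × A × {x : E // x ≠ e'}) :=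
    SA.image fun p => (proj hne p.1, p.2.1, proj hne p.2.2)
  have hE : Fintype.card {x : E // x ≠ e'} + 1 = Fintype.card E := by
    have h1 := Fintype.card_subtype_compl (fun x : E => x = e')
    have h2 : 0 < Fintype.card E := Fintype.card_pos_iff.2 ⟨e⟩
    simp at h1 ⊢
    omega
  have hmap : ∀ {x g y}, Gen (Tot SA SB) x g y →
      Gen (Tot SA' SB') (proj hne x) g (proj hne y) := by
    intro x g y hg
    refine Gen.lift (proj hne) (MonoidHom.id _) ?_ hg
    rintro x g y (⟨a, rfl, hm⟩ | ⟨a, rfl, hm⟩)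
    · exact Gen.of (Or.inl ⟨a, rfl, Finset.mem_image.2 ⟨(x, a, y), hm, rfl⟩⟩)
    · exact Gen.lift (t := Tot SA' SB') id Coprod.inr (fun x a y hm => Gen.of (Or.inr ⟨a, rfl, hm⟩)) (hS _ _ _ hm)
  refine ⟨Fintype.card {x : E // x ≠ e'}, by omega, {x : E // x ≠ e'}, inferInstance, SA', SB',
    rfl, Fintype.card_pos_iff.2 ⟨⟨e, hne⟩⟩, ?_, ?_⟩
  · have c2 : SA'.card ≤ SA.card := Finset.card_image_le
    omega
  · intro x g y
    have := hmap (hall x.1 g y.1)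
    simpa [proj, x.2, y.2] using this

open scoped Pointwise in
open Classical in
/-- A folded `A`-graph on `E` comes from an action of `A` on a larger set; moreover on any set
`X` in which the larger set embeds compatibly with a given embedding of `E`. -/
theorem exists_action {E A X : Type*} [Group A] (s : E → A → E → Prop)
    (hs : ∀ e e', Gen s e 1 e' → e = e') (j : E → X) (hj : Function.Injective j)
    (k : (E → Set A) → X) (hk : Function.Injective k) (hjk : ∀ e f, j e ≠ k f) :
    ∃ ρ : A →* Equiv.Perm X, ∀ e a e', ρ a (j e') = j e ↔ Gen s e a e' := by
  let U : E → (E → Set A) := fun e x => {a | Gen s e a x}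
  have hU : ∀ e a e', a • U e' = U e ↔ Gen s e a e' := by
    intro e a e'
    constructor
    · intro h
      have h1 : a ∈ U e e' := by
        rw [← h]
        exact ⟨1, Gen.refl _, by simp⟩
      exact h1
    · intro h
      funext x
      ext b
      constructor
      · rintro ⟨d, hd, rfl⟩
        exact h.trans hd
      · intro hb
        exact ⟨a⁻¹ * b, h.symm.trans hb, by simp⟩
  have hUinj : Function.Injective U := by
    intro e e' h
    exact hs _ _ ((hU e 1 e').1 (by rw [one_smul, h]))
  let ι : (E → Set A) → X := fun f => if h : ∃ e, U e = f then j h.choose else k f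
  have hιU : ∀ e, ι (U e) = j e := by
    intro e
    have h : ∃ e', U e' = U e := ⟨e, rfl⟩
    simp only [ι, dif_pos h]
    exact congrArg j (hUinj h.choose_spec)
  have hι : Function.Injective ι := by
    intro f f' h
    by_cases h1 : ∃ e, U e = f
    · obtain ⟨e, rfl⟩ := h1
      rw [hιU] at h
      by_cases h2 : ∃ e, U e = f'
      · obtain ⟨e', rfl⟩ := h2
        rw [hιU] at h
        rw [hj h]
      · simp only [ι, dif_neg h2] at h
        exact absurd h (hjk _ _)
    · by_cases h2 : ∃ e, U e = f'
      · obtain ⟨e', rfl⟩ := h2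
        rw [hιU] at h
        simp only [ι, dif_neg h1] at h
        exact absurd h.symm (hjk _ _)
      · simp only [ι, dif_neg h1, dif_neg h2] at h
        exact hk h
  let F := Equiv.ofInjective ι hι
  refine ⟨(Equiv.Perm.extendDomainHom (p := fun x => x ∈ Set.range ι) F).comp
    (MulAction.toPermHom A (E → Set A)), ?_⟩
  intro e a e'
  rw [← hU, ← hιU e', ← hιU e]
  have h1 := Equiv.Perm.extendDomain_apply_image (p := fun x => x ∈ Set.range ι)
    (MulAction.toPermHom A (E → Set A) a) F (U e')
  have h2 : ((MulAction.toPermHom A (E → Set A) a).extendDomain (p := fun x => x ∈ Set.range ι) F)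
      (ι (U e')) = ι (a • U e') := h1
  change ((MulAction.toPermHom A (E → Set A) a).extendDomain (p := fun x => x ∈ Set.range ι) F)
      (ι (U e')) = _ ↔ _
  rw [h2]
  exact hι.eq_iff

theorem label_mem {E A : Type*} [Group A] {s : E → A → E → Prop} {x : E} {a : A} {y : E}
    (h : Gen s x a y) : a ∈ Subgroup.closure {a | ∃ x y, s x a y} := by
  induction h with
  | refl => exact Subgroup.one_mem _
  | of h => exact Subgroup.subset_closure ⟨_, _, h⟩
  | symm _ ih => exact Subgroup.inv_mem _ ih
  | trans _ _ h1 h2 => exact Subgroup.mul_mem _ h1 h2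

theorem rank_le {A : Type*} [Group A] (S : Finset A) (h : Subgroup.closure (S : Set A) = ⊤) :
    groupRank A ≤ S.card := Nat.sInf_le ⟨S, rfl, h⟩

theorem rank_le_of_gen {E A : Type*} [Group A] (S : Finset (E × A × E)) (e : E)
    (h : ∀ a, Gen (Mem S) e a e) : groupRank A ≤ S.card := by
  classical
  refine (rank_le (S.image fun p => p.2.1) ?_).trans Finset.card_image_le
  rw [eq_top_iff]
  intro a _
  have := label_mem (h a)
  convert this using 2
  ext b
  simp [Mem]

theorem lower {n m : ℕ} (h : P A B n m) : groupRank A + groupRank B ≤ n := by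
  induction m using Nat.strong_induction_on with
  | _ m ih =>
  obtain ⟨E, _, SA, SB, rfl, hpos, hc, hall⟩ := h
  by_cases hA : ∃ e e', e ≠ e' ∧ Gen (Mem SA) e 1 e'
  · obtain ⟨e, e', hne, hg⟩ := hA
    obtain ⟨m, hm, hP⟩ := P_foldA hc hall hne hg
    exact ih m hm hP
  by_cases hB : ∃ e e', e ≠ e' ∧ Gen (Mem SB) e 1 e'
  · obtain ⟨e, e', hne, hg⟩ := hB
    obtain ⟨m, hm, hP⟩ := P_foldB hc hall hne hg
    exact ih m hm hP
  have hA' : ∀ e e', Gen (Mem SA) e 1 e' → e = e' := by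
    intro e e' h; by_contra hne; exact hA ⟨e, e', hne, h⟩
  have hB' : ∀ e e', Gen (Mem SB) e 1 e' → e = e' := by
    intro e e' h; by_contra hne; exact hB ⟨e, e', hne, h⟩
  let j : E → E ⊕ ((E → Set A) ⊕ (E → Set B)) := Sum.inl
  obtain ⟨ρA, hρA⟩ := exists_action (Mem SA) hA' j Sum.inl_injective
    (fun f => Sum.inr (Sum.inl f)) (Sum.inr_injective.comp Sum.inl_injective) (by simp [j])
  obtain ⟨ρB, hρB⟩ := exists_action (Mem SB) hB' j Sum.inl_injective
    (fun f => Sum.inr (Sum.inr f)) (Sum.inr_injective.comp Sum.inr_injective) (by simp [j])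
  let ρ := Coprod.lift ρA ρB
  have hρ : ∀ x g y, Gen (Tot SA SB) x g y → ρ g (j y) = j x := by
    intro x g y hg
    induction hg with
    | refl => simp
    | of h =>
      rcases h with ⟨a, rfl, hm⟩ | ⟨a, rfl, hm⟩
      · simpa [ρ] using (hρA _ _ _).2 (Gen.of hm)
      · simpa [ρ] using (hρB _ _ _).2 (Gen.of hm)
    | symm _ ih => rw [← ih, map_inv]; simp
    | trans _ _ h1 h2 => rw [map_mul, Equiv.Perm.mul_apply, h2, h1]
  obtain ⟨e⟩ := Fintype.card_pos_iff.1 hpos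
  have hsub : Fintype.card E ≤ 1 := by
    rw [Fintype.card_le_one_iff]
    intro x y
    have := hρ _ _ _ (hall x 1 y)
    simp only [map_one, Equiv.Perm.one_apply] at this
    exact (Sum.inl_injective this).symm
  have h1 : groupRank A ≤ SA.card := by
    refine rank_le_of_gen SA e fun a => (hρA _ _ _).1 ?_
    simpa [ρ] using hρ _ _ _ (hall e (Coprod.inl a) e)
  have h2 : groupRank B ≤ SB.card := by
    refine rank_le_of_gen SB e fun a => (hρB _ _ _).1 ?_
    simpa [ρ] using hρ _ _ _ (hall e (Coprod.inr a) e)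
  omega

end Graphs

theorem exists_rank (G : Type*) [Group G] [Group.FG G] :
    ∃ S : Finset G, S.card = groupRank G ∧ Subgroup.closure (S : Set G) = ⊤ := by
  obtain ⟨S, hS⟩ := (Group.fg_def.1 (inferInstance : Group.FG G))
  exact Nat.sInf_mem (s := {n : ℕ | ∃ S : Finset G, S.card = n ∧
    Subgroup.closure (S : Set G) = ⊤}) ⟨S.card, S, rfl, hS⟩

open Classical in
theorem upper {A B : Type*} [Group A] [Group B] (S : Finset A) (T : Finset B)
    (hS : Subgroup.closure (S : Set A) = ⊤) (hT : Subgroup.closure (T : Set B) = ⊤) :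
    ∃ U : Finset (Monoid.Coprod A B), U.card ≤ S.card + T.card ∧
      Subgroup.closure (U : Set (Monoid.Coprod A B)) = ⊤ := by
  refine ⟨S.image Monoid.Coprod.inl ∪ T.image Monoid.Coprod.inr,
    (Finset.card_union_le _ _).trans (Nat.add_le_add Finset.card_image_le Finset.card_image_le), ?_⟩
  rw [Finset.coe_union, Finset.coe_image, Finset.coe_image, Subgroup.closure_union,
    ← MonoidHom.map_closure, ← MonoidHom.map_closure, hS, hT, ← MonoidHom.range_eq_map,
    ← MonoidHom.range_eq_map]
  exact Monoid.Coprod.range_inl_sup_range_inr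

end GrushkoAux

/-- **Grushko's theorem**: if `G₁` and `G₂` are nontrivial finitely generated groups, then
the rank of their free product `G₁ ∗ G₂` is the sum of the ranks of `G₁` and `G₂`. -/
theorem grushko (G₁ G₂ : Type*) [Group G₁] [Group G₂]
    [Group.FG G₁] [Group.FG G₂] [Nontrivial G₁] [Nontrivial G₂] :
    groupRank (Monoid.Coprod G₁ G₂) = groupRank G₁ + groupRank G₂ := by
  obtain ⟨S, hS, hS'⟩ := GrushkoAux.exists_rank G₁
  obtain ⟨T, hT, hT'⟩ := GrushkoAux.exists_rank G₂
  obtain ⟨U, hU, hU'⟩ := GrushkoAux.upper S T hS' hT'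
  apply le_antisymm
  · have := GrushkoAux.rank_le U hU'
    omega
  · obtain ⟨V, hV, hV'⟩ : ∃ V : Finset (Monoid.Coprod G₁ G₂),
        V.card = groupRank (Monoid.Coprod G₁ G₂) ∧
        Subgroup.closure (V : Set (Monoid.Coprod G₁ G₂)) = ⊤ :=
      Nat.sInf_mem (s := {n : ℕ | ∃ S : Finset (Monoid.Coprod G₁ G₂), S.card = n ∧
        Subgroup.closure (S : Set (Monoid.Coprod G₁ G₂)) = ⊤}) ⟨U.card, U, rfl, hU'⟩
    obtain ⟨m, hP⟩ := GrushkoAux.exists_P V hV'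
    have := GrushkoAux.lower hP
    omega
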